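/- arXiv:2306.11836 — 2 statements merged into one kernel-verified Lean document; each statement's English description precedes it below -/
import Mathlib

section
/- For positive integers n, m, r and any k₁, k₂ with 1 ≤ k₁, k₂ ≤ r, the number of permutations of [n] with exactly m r-descents ending in k₁ equals the number of permutations of [n] with exactly m r-descents ending in k₂. -/
/-- Number of `r`-descents of a permutation `σ` of `[n]` (positions `i < n` with
`σ(i) ≥ σ(i+1) + r`), encoded on `Fin n`. -/
def rDesc (n r : ℕ) (σ : Equiv.Perm (Fin n)) : ℕ :=
  (Finset.univ.filter fun i : Fin n =>
    (if h : (i : ℕ) + 1 < n then ((σ ⟨(i : ℕ) + 1, h⟩ : Fin n) : ℕ) else n) + r ≤ (σ i : ℕ)).card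

/-- Number of `r`-excedances of a permutation `σ` of `[n]` (positions `i ≤ n` with
`σ(i) ≥ i + r`), encoded on `Fin n`. -/
def rExc (n r : ℕ) (σ : Equiv.Perm (Fin n)) : ℕ :=
  (Finset.univ.filter fun i : Fin n => (i : ℕ) + r ≤ (σ i : ℕ)).card

/-- The last value `σ(n)` of a permutation of `[n]` (as an element of `{1,…,n}`). -/
def lastVal (n : ℕ) (σ : Equiv.Perm (Fin n)) : ℕ :=
  if h : 0 < n then ((σ ⟨n - 1, Nat.sub_lt h Nat.one_pos⟩ : Fin n) : ℕ) + 1 else 0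

/-- `Ar r n m k` = number of permutations of `[n]` with exactly `m` `r`-descents
whose last value is `k`. -/
def Ar (r n m k : ℕ) : ℕ :=
  (Finset.univ.filter fun σ : Equiv.Perm (Fin n) => rDesc n r σ = m ∧ lastVal n σ = k).card

/-- Cyclic `r`-descents of a word. -/
def cycDesc (N r : ℕ) (σ : Equiv.Perm (Fin (N + 1))) : ℕ :=
  (Finset.univ.filter fun i : Fin (N + 1) => (σ (i + 1) : ℕ) + r ≤ (σ i : ℕ)).card

/-- Rotate the word so that it ends in the value `b`. -/
def rotTo (N : ℕ) (b : Fin (N + 1)) (σ : Equiv.Perm (Fin (N + 1))) :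
    Equiv.Perm (Fin (N + 1)) :=
  (Equiv.addRight (σ.symm b - Fin.last N)).trans σ

lemma rotTo_last (N : ℕ) (b : Fin (N + 1)) (σ : Equiv.Perm (Fin (N + 1))) :
    rotTo N b σ (Fin.last N) = b := by
  simp [rotTo]

lemma rotTo_rotTo (N : ℕ) (a b : Fin (N + 1)) (σ : Equiv.Perm (Fin (N + 1)))
    (h : σ (Fin.last N) = a) : rotTo N a (rotTo N b σ) = σ := by
  have h' : σ.symm a = Fin.last N := by rw [← h]; simp
  have h2 : (rotTo N b σ).symm a = Fin.last N - (σ.symm b - Fin.last N) := by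
    rw [Equiv.symm_apply_eq]
    simp [rotTo, h]
  ext i
  rw [rotTo, h2]
  simp only [Equiv.trans_apply, Equiv.coe_addRight, rotTo]
  congr 2
  abel

lemma cycDesc_rotTo (N r : ℕ) (b : Fin (N + 1)) (σ : Equiv.Perm (Fin (N + 1))) :
    cycDesc N r (rotTo N b σ) = cycDesc N r σ := by
  unfold cycDesc
  refine Finset.card_equiv (Equiv.addRight (σ.symm b - Fin.last N)) ?_
  intro i
  rw [Finset.mem_filter, Finset.mem_filter]
  simp only [Finset.mem_univ, true_and, rotTo, Equiv.trans_apply, Equiv.coe_addRight]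
  rw [add_right_comm]

lemma rDesc_eq_cycDesc (N r : ℕ) (σ : Equiv.Perm (Fin (N + 1)))
    (h : (σ (Fin.last N) : ℕ) < r) : rDesc (N + 1) r σ = cycDesc N r σ := by
  unfold rDesc cycDesc
  congr 1
  apply Finset.filter_congr
  intro i _
  split_ifs with hi
  · have : (⟨(i : ℕ) + 1, hi⟩ : Fin (N + 1)) = i + 1 := by
      apply Fin.ext
      rw [Fin.val_add_one_of_lt]
      rw [Fin.lt_def]
      simpa using hi
    rw [this]
  · have : i = Fin.last N := by
      apply Fin.ext
      have := i.isLt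
      simp only [Fin.val_last]
      omega
    subst this
    have := (σ (Fin.last N)).isLt
    constructor <;> intro h <;> omega

lemma lastVal_succ (N : ℕ) (σ : Equiv.Perm (Fin (N + 1))) :
    lastVal (N + 1) σ = (σ (Fin.last N) : ℕ) + 1 := by
  simp [lastVal]
  rfl

lemma Ar_eq_zero (n m r k : ℕ) (hm : 1 ≤ m) (h : n < r) : Ar r n m k = 0 := by
  unfold Ar
  rw [Finset.card_eq_zero, Finset.filter_eq_empty_iff]
  rintro σ - ⟨h1, -⟩
  have : rDesc n r σ = 0 := by
    unfold rDesc
    rw [Finset.card_eq_zero, Finset.filter_eq_empty_iff]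
    intro i _
    have := (σ i).isLt
    omega
  omega

/-- For `k₁, k₂ ≤ r`, the counts `A_r(n,m,k₁)` and `A_r(n,m,k₂)` agree. -/
theorem stmt3 (n m r k₁ k₂ : ℕ) (hn : 1 ≤ n) (hm : 1 ≤ m) (hr : 1 ≤ r)
    (hk₁ : 1 ≤ k₁) (hk₁r : k₁ ≤ r) (hk₂ : 1 ≤ k₂) (hk₂r : k₂ ≤ r) :
    Ar r n m k₁ = Ar r n m k₂ := by
  by_cases hnr : n < r
  · rw [Ar_eq_zero n m r k₁ hm hnr, Ar_eq_zero n m r k₂ hm hnr]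
  obtain ⟨N, rfl⟩ : ∃ N, n = N + 1 := ⟨n - 1, by omega⟩
  obtain ⟨a, rfl⟩ : ∃ a : Fin (N + 1), k₁ = (a : ℕ) + 1 :=
    ⟨⟨k₁ - 1, by omega⟩, by simp only; omega⟩
  obtain ⟨b, rfl⟩ : ∃ b : Fin (N + 1), k₂ = (b : ℕ) + 1 :=
    ⟨⟨k₂ - 1, by omega⟩, by simp only; omega⟩
  have key : ∀ c d : Fin (N + 1), (c : ℕ) + 1 ≤ r → (d : ℕ) + 1 ≤ r →
      ∀ σ : Equiv.Perm (Fin (N + 1)), (rDesc (N + 1) r σ = m ∧ σ (Fin.last N) = c) →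
      (rDesc (N + 1) r (rotTo N d σ) = m ∧ rotTo N d σ (Fin.last N) = d) := by
    rintro c d hc hd σ ⟨h1, h2⟩
    refine ⟨?_, rotTo_last N d σ⟩
    rw [rDesc_eq_cycDesc N r _ (by rw [rotTo_last]; omega), cycDesc_rotTo,
      ← rDesc_eq_cycDesc N r _ (by rw [h2]; omega), h1]
  unfold Ar
  simp only [lastVal_succ, Nat.add_right_cancel_iff, ← Fin.ext_iff]
  refine Finset.card_bij' (fun σ _ => rotTo N b σ) (fun σ _ => rotTo N a σ) ?_ ?_ ?_ ?_
  · intro σ hσ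
    simp only [Finset.mem_filter, Finset.mem_univ, true_and] at hσ ⊢
    exact key a b hk₁r hk₂r σ hσ
  · intro σ hσ
    simp only [Finset.mem_filter, Finset.mem_univ, true_and] at hσ ⊢
    exact key b a hk₂r hk₁r σ hσ
  · intro σ hσ
    simp only [Finset.mem_filter, Finset.mem_univ, true_and] at hσ
    exact rotTo_rotTo N a b σ hσ.2
  · intro σ hσ
    simp only [Finset.mem_filter, Finset.mem_univ, true_and] at hσ
    exact rotTo_rotTo N b a σ hσ.2
end

section
/- For positive integers n, m, r and 2 ≤ k < n: A_{r+1}(n,m,k) = A_r(n, m+1, k−1) + (r−1)·(A_r(n−1, m, k−1) − A_r(n−1, m+1, k−1)). -/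
namespace RD

/-- number of r-descents of a word -/
def dsc (r : ℕ) : List ℕ → ℕ
  | [] => 0
  | [_] => 0
  | a :: b :: l => (if b + r ≤ a then 1 else 0) + dsc r (b :: l)

/-- last letter of a word -/
def lst : List ℕ → ℕ
  | [] => 0
  | [a] => a
  | _ :: b :: l => lst (b :: l)

/-- all words that are permutations of 0, ..., n-1 -/
def W : ℕ → List (List ℕ)
  | 0 => [[]]
  | n + 1 => (W n).flatMap (List.permutations'Aux n)

/-- number of letters b with n < b + r -/
def big (r n : ℕ) (l : List ℕ) : ℕ := l.countP (fun b => decide (n < b + r))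

lemma ins_cons (r n : ℕ) (hr : 1 ≤ r) (l : List ℕ) : ∀ (a : ℕ) (f : ℕ → ℕ → ℤ),
    (∀ b ∈ a :: l, b < n) →
    ((List.permutations'Aux n l).map (fun z => f (dsc r (a :: z)) (lst (a :: z)))).sum =
      f (dsc r (a :: l)) n
      + ((dsc r (a :: l) : ℤ) + big r n l) * f (dsc r (a :: l)) (lst (a :: l))
      + ((l.length : ℤ) - dsc r (a :: l) - big r n l) * f (dsc r (a :: l) + 1) (lst (a :: l)) := by
  induction l with
  | nil =>
    intro a f h
    have : a < n := h a (by simp)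
    have h2 : ¬ (n + r ≤ a) := by omega
    simp [dsc, lst, big, h2]
  | cons b l ih =>
    intro a f h
    have ha : a < n := h a (by simp)
    have h2 : ¬ (n + r ≤ a) := by omega
    have hb := ih b (fun d s => f ((if b + r ≤ a then 1 else 0) + d) s)
      (fun c hc => h c (List.mem_cons_of_mem _ hc))
    simp only [List.permutations'Aux, List.map_cons, List.sum_cons, List.map_map]
    have e : ((fun z => f (dsc r (a :: z)) (lst (a :: z))) ∘ List.cons b) =
        (fun z => f ((if b + r ≤ a then 1 else 0) + dsc r (b :: z)) (lst (b :: z))) := by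
      funext z; simp [dsc, lst]
    rw [e, hb]
    simp only [dsc, lst, big, List.countP_cons, List.length_cons, if_neg h2, zero_add]
    by_cases h3 : b + r ≤ a
    · have h4 : b + r ≤ n := by omega
      have h5 : ¬ (n < b + r) := by omega
      simp only [h3, h4, h5, if_true, decide_false]
      simp [add_assoc]
      ring
    · by_cases h4 : b + r ≤ n
      · have h5 : ¬ (n < b + r) := by omega
        simp only [h3, h4, h5, if_true, if_false, decide_false]
        simp [add_comm 1]
        ring
      · have h5 : (n < b + r) := by omega
        simp only [h3, h4, h5, if_true, if_false, decide_true]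
        simp
        ring

lemma ins_sum (r n : ℕ) (hr : 1 ≤ r) (l : List ℕ) (f : ℕ → ℕ → ℤ) (h : ∀ b ∈ l, b < n) :
    ((List.permutations'Aux n l).map (fun z => f (dsc r z) (lst z))).sum =
      f (dsc r l) n
      + ((dsc r l : ℤ) + big r n l) * f (dsc r l) (lst l)
      + ((l.length : ℤ) - dsc r l - big r n l) * f (dsc r l + 1) (lst l) := by
  cases l with
  | nil => simp [dsc, lst, big]
  | cons b l =>
    have hb := ins_cons r n hr l b f h
    simp only [List.permutations'Aux, List.map_cons, List.sum_cons, List.map_map]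
    have e : ((fun z => f (dsc r z) (lst z)) ∘ List.cons b) =
        (fun z => f (dsc r (b :: z)) (lst (b :: z))) := by
      funext z; simp
    rw [e, hb]
    simp only [dsc, lst, big, List.countP_cons, List.length_cons]
    by_cases h4 : b + r ≤ n
    · have h5 : ¬ (n < b + r) := by omega
      simp only [h4, h5, if_true, decide_false]
      simp [add_comm 1]
      ring
    · have h5 : (n < b + r) := by omega
      simp only [h4, h5, if_false, decide_true]
      simp
      ring

lemma W_eq (n : ℕ) : W n = List.permutations' (List.range n).reverse := by
  induction n with
  | zero => simp [W]
  | succ n ih => simp [W, ih, List.range_succ]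

lemma mem_W (n : ℕ) (l : List ℕ) : l ∈ W n ↔ l.Perm (List.range n) := by
  rw [W_eq, List.mem_permutations']
  exact ⟨fun h => h.trans (List.reverse_perm _), fun h => h.trans (List.reverse_perm _).symm⟩

lemma nodup_W (n : ℕ) : (W n).Nodup := by
  rw [W_eq]
  exact (List.permutations_perm_permutations' _).nodup_iff.1
    (List.nodup_permutations _ (List.nodup_reverse.2 List.nodup_range))

lemma big_W (r n : ℕ) (hr : 1 ≤ r) (l : List ℕ) (h : l ∈ W n) : big r n l = min (r - 1) n := by
  rw [mem_W] at h
  rw [big, h.countP_eq]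
  have key : ∀ j, (List.range j).countP (fun b => decide (n < b + r)) = j - (n + 1 - r) := by
    intro j
    induction j with
    | zero => simp
    | succ j ih =>
      rw [List.range_succ, List.countP_append, ih]
      by_cases h5 : n < j + r
      · simp [h5]; omega
      · simp [h5]; omega
  rw [key]; omega

lemma W_sum (r n : ℕ) (hr : 1 ≤ r) (f : ℕ → ℕ → ℤ) :
    ((W (n + 1)).map (fun z => f (dsc r z) (lst z))).sum =
    ((W n).map (fun l => f (dsc r l) n
      + ((dsc r l : ℤ) + (min (r - 1) n : ℕ)) * f (dsc r l) (lst l)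
      + ((n : ℤ) - dsc r l - (min (r - 1) n : ℕ)) * f (dsc r l + 1) (lst l))).sum := by
  rw [W, List.map_flatMap, List.flatMap, List.sum_flatten, List.map_map]
  congr 1
  apply List.map_congr_left
  intro l hl
  have hb := big_W r n hr l hl
  have hp := (mem_W n l).1 hl
  have hlen : l.length = n := by simpa using hp.length_eq
  have := ins_sum r n hr l f (fun b hb => by simpa using (hp.mem_iff.1 hb))
  simp only [Function.comp]
  rw [this, hb, hlen]

/-- number of words with m r-descents ending in k -/
def B (r n : ℕ) (m : ℤ) (k : ℕ) : ℤ :=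
  ((W n).map (fun l => if (dsc r l : ℤ) = m ∧ lst l = k then (1 : ℤ) else 0)).sum

/-- number of words with m r-descents -/
def S (r n : ℕ) (m : ℤ) : ℤ :=
  ((W n).map (fun l => if (dsc r l : ℤ) = m then (1 : ℤ) else 0)).sum

lemma lst_mem (l : List ℕ) (h : l ≠ []) : lst l ∈ l := by
  induction l with
  | nil => exact absurd rfl h
  | cons a l ih =>
    cases l with
    | nil => simp [lst]
    | cons b l => exact List.mem_cons_of_mem _ (ih (by simp))

lemma lst_lt (n : ℕ) (hn : 1 ≤ n) (l : List ℕ) (h : l ∈ W n) : lst l < n := by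
  have hp := (mem_W n l).1 h
  have hne : l ≠ [] := by
    rintro rfl
    have := hp.length_eq
    simp at this; omega
  simpa using hp.mem_iff.1 (lst_mem l hne)

lemma S_rec (r n : ℕ) (hr : 1 ≤ r) (m : ℤ) :
    S r (n + 1) m = (m + 1 + (min (r - 1) n : ℕ)) * S r n m
      + (n + 1 - m - (min (r - 1) n : ℕ)) * S r n (m - 1) := by
  unfold S
  rw [W_sum r n hr (fun d _ => if (d : ℤ) = m then (1 : ℤ) else 0)]
  rw [← List.sum_map_mul_left, ← List.sum_map_mul_left, ← List.sum_map_add]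
  congr 1
  apply List.map_congr_left
  intro l _
  generalize dsc r l = d
  push_cast
  by_cases h1 : (d : ℤ) = m
  · have h2 : ¬ ((d : ℤ) = m - 1) := by omega
    have h3 : ¬ ((d : ℤ) + 1 = m) := by omega
    rw [if_pos h1, if_neg h2, if_neg h3, h1]
    ring
  · by_cases h2 : (d : ℤ) = m - 1
    · have h3 : ((d : ℤ) + 1 = m) := by omega
      simp only [h1, h2, if_true, if_false]
      simp
      ring
    · have h3 : ¬ ((d : ℤ) + 1 = m) := by omega
      simp [h1, h2, h3]

lemma B_rec (r n : ℕ) (hr : 1 ≤ r) (m : ℤ) (k : ℕ) (hk : k < n) :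
    B r (n + 1) m k = (m + (min (r - 1) n : ℕ)) * B r n m k
      + (n + 1 - m - (min (r - 1) n : ℕ)) * B r n (m - 1) k := by
  unfold B
  rw [W_sum r n hr (fun d s => if (d : ℤ) = m ∧ s = k then (1 : ℤ) else 0)]
  rw [← List.sum_map_mul_left, ← List.sum_map_mul_left, ← List.sum_map_add]
  congr 1
  apply List.map_congr_left
  intro l _
  generalize dsc r l = d
  have hnk : n ≠ k := by omega
  push_cast
  by_cases h0 : lst l = k
  · by_cases h1 : (d : ℤ) = m
    · have h2 : ¬ ((d : ℤ) = m - 1) := by omega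
      have h3 : ¬ ((d : ℤ) + 1 = m) := by omega
      simp only [h0, hnk, and_true, and_false, if_false]
      rw [if_pos h1, if_neg h2, if_neg h3, h1]
      ring
    · by_cases h2 : (d : ℤ) = m - 1
      · have h3 : ((d : ℤ) + 1 = m) := by omega
        simp only [h0, hnk, h1, h2, and_true, and_false, if_true, if_false]
        simp
        ring
      · have h3 : ¬ ((d : ℤ) + 1 = m) := by omega
        simp [h1, h2, h3]
  · simp [h0, hnk]

lemma B_top (r n : ℕ) (hr : 1 ≤ r) (hn : 1 ≤ n) (m : ℤ) :
    B r (n + 1) m n = S r n m := by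
  unfold B S
  rw [W_sum r n hr (fun d s => if (d : ℤ) = m ∧ s = n then (1 : ℤ) else 0)]
  congr 1
  apply List.map_congr_left
  intro l hl
  have := (lst_lt n hn l hl).ne
  simp [this]

lemma S_id (r N : ℕ) (hr : 1 ≤ r) : ∀ m : ℤ,
    S (r + 1) (N + 1) m = (m + 1) * S r N (m + 1) + (N + 1 - m) * S r N m := by
  induction N with
  | zero =>
    intro m
    simp [S, W, dsc]
    by_cases h : (0 : ℤ) = m
    · subst h; simp
    · by_cases h2 : 0 = m + 1
      · rw [← h2]; simp [h]
      · simp [h, h2]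
  | succ N ih =>
    intro m
    rw [S_rec (r + 1) (N + 1) (by omega) m, ih, ih, S_rec r N hr, S_rec r N hr]
    have : min (r + 1 - 1) (N + 1) = min (r - 1) N + 1 := by omega
    rw [this]
    push_cast
    generalize ((min (r - 1) N : ℕ) : ℤ) = c
    simp only [sub_add_cancel, add_sub_cancel_right]
    ring

lemma B_id (r k j : ℕ) (hr : 1 ≤ r) : ∀ m : ℤ,
    B (r + 1) (k + 2 + j) m (k + 1) = (m + 1) * B r (k + 1 + j) (m + 1) k
      + (k + 1 + j - m) * B r (k + 1 + j) m k := by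
  induction j with
  | zero =>
    intro m
    rw [add_zero, add_zero, B_top (r + 1) (k + 1) (by omega) (by omega), S_id r k hr]
    rcases Nat.eq_zero_or_pos k with rfl | hk
    · simp [S, B, W, dsc, lst]
    · rw [B_top r k hr hk, B_top r k hr hk]
      push_cast; ring
  | succ j ih =>
    intro m
    rw [← add_assoc, ← add_assoc, B_rec (r + 1) (k + 2 + j) (by omega) m _ (by omega), ih, ih,
      B_rec r _ hr _ _ (by omega), B_rec r _ hr _ _ (by omega)]
    have : min (r + 1 - 1) (k + 2 + j) = min (r - 1) (k + 1 + j) + 1 := by omega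
    rw [this]
    push_cast
    generalize ((min (r - 1) (k + 1 + j) : ℕ) : ℤ) = c
    simp only [sub_add_cancel, add_sub_cancel_right]
    ring

lemma dsc_zero (r n : ℕ) (hrn : n ≤ r) (l : List ℕ) (h : ∀ b ∈ l, b < n) : dsc r l = 0 := by
  induction l with
  | nil => rfl
  | cons a l ih =>
    cases l with
    | nil => rfl
    | cons b l =>
      have h1 := h a (by simp)
      have h2 : ¬ (b + r ≤ a) := by omega
      simp only [dsc, if_neg h2, zero_add]
      exact ih (fun c hc => h c (List.mem_cons_of_mem _ hc))

lemma B_zero (r n : ℕ) (hrn : n ≤ r) (m : ℤ) (hm : m ≠ 0) (k : ℕ) : B r n m k = 0 := by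
  unfold B
  apply List.sum_eq_zero
  intro x hx
  rw [List.mem_map] at hx
  obtain ⟨l, hl, rfl⟩ := hx
  have hp := (mem_W n l).1 hl
  rw [dsc_zero r n hrn l (fun b hb => by simpa using (hp.mem_iff.1 hb))]
  simp [hm.symm]

lemma dsc_eq (r : ℕ) (l : List ℕ) : dsc r l = ∑ i ∈ Finset.range l.length,
    if i + 1 < l.length ∧ l.getD (i + 1) 0 + r ≤ l.getD i 0 then 1 else 0 := by
  induction l with
  | nil => rfl
  | cons a l ih =>
    cases l with
    | nil => simp [dsc]
    | cons b l =>
      rw [dsc, ih, List.length_cons (as := b :: l), Finset.sum_range_succ', add_comm]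
      congr 1
      · apply Finset.sum_congr rfl
        intro i _
        simp
      · simp

lemma lst_eq (l : List ℕ) : lst l = l.getD (l.length - 1) 0 := by
  induction l with
  | nil => rfl
  | cons a l ih =>
    cases l with
    | nil => rfl
    | cons b l => rw [lst, ih]; simp

/-- word of a permutation -/
def word (n : ℕ) (σ : Equiv.Perm (Fin n)) : List ℕ := List.ofFn (fun i => (σ i : ℕ))

lemma word_getD (n : ℕ) (σ : Equiv.Perm (Fin n)) (i : ℕ) (h : i < n) :
    (word n σ).getD i 0 = (σ ⟨i, h⟩ : ℕ) := by
  rw [List.getD_eq_getElem _ _ (by simpa [word] using h)]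
  simp [word]

lemma dsc_word (n r : ℕ) (σ : Equiv.Perm (Fin n)) : dsc r (word n σ) = rDesc n r σ := by
  rw [dsc_eq, rDesc, Finset.card_filter]
  have hl : (word n σ).length = n := by simp [word]
  rw [hl, Finset.sum_range]
  apply Finset.sum_congr rfl
  intro i _
  rw [word_getD n σ i i.2]
  by_cases h : (i : ℕ) + 1 < n
  · rw [word_getD n σ _ h]; simp [h]
  · have := (σ i).2
    have h2 : ¬ (n + r ≤ (σ i : ℕ)) := by omega
    simp [h, h2]

lemma lst_word (n : ℕ) (hn : 0 < n) (σ : Equiv.Perm (Fin n)) :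
    lst (word n σ) + 1 = lastVal n σ := by
  have hl : (word n σ).length = n := by simp [word]
  rw [lst_eq, hl, word_getD n σ (n - 1) (by omega), lastVal, dif_pos hn]

lemma word_mem (n : ℕ) (σ : Equiv.Perm (Fin n)) : word n σ ∈ W n := by
  rw [mem_W]
  rw [List.perm_ext_iff_of_nodup _ List.nodup_range]
  · intro a
    simp only [word, List.mem_ofFn, List.mem_range, Set.mem_range]
    constructor
    · rintro ⟨i, rfl⟩; exact (σ i).2
    · intro h; exact ⟨σ.symm ⟨a, h⟩, by simp⟩
  · rw [word, List.nodup_ofFn]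
    exact fun i j h => σ.injective (Fin.ext h)

lemma word_inj (n : ℕ) : Function.Injective (word n) := by
  intro σ τ h
  ext i
  exact congrFun (List.ofFn_injective h) i

lemma word_surj (n : ℕ) (l : List ℕ) (hl : l ∈ W n) : ∃ σ, word n σ = l := by
  have hp := (mem_W n l).1 hl
  have hlen : l.length = n := by simpa using hp.length_eq
  subst hlen
  have hnd : l.Nodup := hp.nodup_iff.2 List.nodup_range
  let g : Fin l.length → Fin l.length :=
    fun i => ⟨l.get i, by simpa using hp.mem_iff.1 (l.get_mem i)⟩
  have hg : Function.Injective g := by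
    intro i j h
    exact List.nodup_iff_injective_get.1 hnd (congrArg Fin.val h)
  refine ⟨Equiv.ofBijective g (Finite.injective_iff_bijective.1 hg), ?_⟩
  have : (fun i => ((Equiv.ofBijective g (Finite.injective_iff_bijective.1 hg)) i : ℕ)) = l.get := by
    funext i; simp [g]
  rw [word, this, List.ofFn_get]

lemma Ar_eq (r n m k : ℕ) (hn : 0 < n) : (Ar r n m (k + 1) : ℤ) = B r n m k := by
  have h1 : B r n m k = ∑ l ∈ (W n).toFinset,
      if (dsc r l : ℤ) = m ∧ lst l = k then (1 : ℤ) else 0 := by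
    rw [List.sum_toFinset _ (nodup_W n)]; rfl
  rw [h1, Ar, Finset.card_filter]
  push_cast
  refine Finset.sum_bij (fun σ _ => word n σ) ?_ ?_ ?_ ?_
  · intro σ _; simpa using word_mem n σ
  · intro σ _ τ _ h; exact word_inj n h
  · intro l hl
    obtain ⟨σ, h⟩ := word_surj n l (by simpa using hl)
    exact ⟨σ, Finset.mem_univ _, h⟩
  · intro σ _
    rw [dsc_word, ← lst_word n hn σ]
    simp

end RD

theorem stmt9 (n m r k : ℕ) (hn : 1 ≤ n) (hm : 1 ≤ m) (hr : 1 ≤ r)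
    (hk : 2 ≤ k) (hkn : k < n) :
    (Ar (r + 1) n m k : ℤ) =
      (Ar r n (m + 1) (k - 1) : ℤ) +
        ((r : ℤ) - 1) * ((Ar r (n - 1) m (k - 1) : ℤ) - (Ar r (n - 1) (m + 1) (k - 1) : ℤ)) := by
  obtain ⟨k, rfl⟩ : ∃ q, k = q + 2 := ⟨k - 2, by omega⟩
  obtain ⟨j, rfl⟩ : ∃ j, n = k + 2 + j := ⟨n - (k + 2), by omega⟩
  have e1 : k + 2 + j - 1 = k + 1 + j := by omega
  have e2 : k + 2 - 1 = k + 1 := by omega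
  have e3 : k + 2 + j = k + 1 + j + 1 := by omega
  rw [e1, e2, RD.Ar_eq (r + 1) _ m (k + 1) (by omega), RD.Ar_eq r _ _ k (by omega),
    RD.Ar_eq r _ _ k (by omega), RD.Ar_eq r _ _ k (by omega)]
  by_cases h : r ≤ k + 2 + j
  · rw [RD.B_id r k j hr, e3, RD.B_rec r _ hr _ k (by omega)]
    have : min (r - 1) (k + 1 + j) = r - 1 := by omega
    rw [this]
    push_cast [Nat.cast_sub hr]
    simp only [add_sub_cancel_right]
    ring
  · rw [RD.B_zero, RD.B_zero, RD.B_zero, RD.B_zero] <;> omega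
end
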